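/- In the setting of mollified singular kernels: if K is of order ζ ∈ (-|s|, 0) and K_ε = K * ρ_ε as above, then for every ζ̄ ∈ [ζ-1, ζ) and every m ≥ 0, ⦀K - K_ε⦀_{ζ̄;m} ≤ C ε^{ζ - ζ̄} ⦀K⦀_{ζ; m̄}, where m̄ = m + max_i s_i and the constant C is uniform over ε ∈ (0,1]. -/

import Mathlib

open MeasureTheory

/-- The scaled norm `‖x‖_s = ∑_i |x_i|^{1/s_i}` on `ℝ^d`. -/
noncomputable def sNorm {d : ℕ} (s : Fin d → ℕ) (x : Fin d → ℝ) : ℝ :=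
  ∑ i, |x i| ^ ((s i : ℝ)⁻¹)

/-- The scaled degree `|k|_s = ∑ s_i k_i` of a multiindex, encoded as a list of directions. -/
def sdeg {d : ℕ} (s : Fin d → ℕ) (ℓ : List (Fin d)) : ℕ := (ℓ.map s).sum

/-- Iterated partial derivative `D^ℓ f` along the list of coordinate directions `ℓ`. -/
noncomputable def mderiv {d : ℕ} : List (Fin d) → ((Fin d → ℝ) → ℝ) → (Fin d → ℝ) → ℝ
  | [], f => f
  | i :: ℓ, f => fun x => fderiv ℝ (mderiv ℓ f) x (Pi.single i 1)

/-! ### Generalities on iterated derivatives -/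

lemma mderiv_congr {d : ℕ} (ℓ : List (Fin d)) {f g : (Fin d → ℝ) → ℝ} {x : Fin d → ℝ}
    (h : f =ᶠ[nhds x] g) : mderiv ℓ f =ᶠ[nhds x] mderiv ℓ g := by
  induction ℓ with
  | nil => exact h
  | cons i ℓ ih =>
    have := Filter.EventuallyEq.fderiv (𝕜 := ℝ) ih
    filter_upwards [this] with y hy
    simp only [mderiv, hy]

lemma mderiv_contDiffOn {d : ℕ} (ℓ : List (Fin d)) {f : (Fin d → ℝ) → ℝ} {U : Set (Fin d → ℝ)}
    (hU : IsOpen U) (hf : ContDiffOn ℝ (⊤ : ℕ∞) f U) :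
    ContDiffOn ℝ (⊤ : ℕ∞) (mderiv ℓ f) U := by
  induction ℓ with
  | nil => exact hf
  | cons i ℓ ih =>
    have h := ih.fderiv_of_isOpen hU (m := (⊤ : ℕ∞)) (by simp)
    exact h.clm_apply contDiffOn_const

lemma mderiv_contDiff {d : ℕ} (ℓ : List (Fin d)) {f : (Fin d → ℝ) → ℝ}
    (hf : ContDiff ℝ (⊤ : ℕ∞) f) : ContDiff ℝ (⊤ : ℕ∞) (mderiv ℓ f) := by
  rw [← contDiffOn_univ] at hf ⊢
  exact mderiv_contDiffOn ℓ isOpen_univ hf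

lemma mderiv_sub {d : ℕ} (ℓ : List (Fin d)) {f g : (Fin d → ℝ) → ℝ} {U : Set (Fin d → ℝ)}
    (hU : IsOpen U) (hf : ContDiffOn ℝ (⊤ : ℕ∞) f U) (hg : ContDiffOn ℝ (⊤ : ℕ∞) g U) :
    ∀ x ∈ U, mderiv ℓ (fun z => f z - g z) x = mderiv ℓ f x - mderiv ℓ g x := by
  induction ℓ with
  | nil => intro x _; rfl
  | cons i ℓ ih =>
    intro x hx
    have h1 : mderiv ℓ (fun z => f z - g z) =ᶠ[nhds x] fun z => mderiv ℓ f z - mderiv ℓ g z := by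
      filter_upwards [hU.mem_nhds hx] with y hy using ih y hy
    have hdf : DifferentiableAt ℝ (mderiv ℓ f) x :=
      ((mderiv_contDiffOn ℓ hU hf).differentiableOn (by simp)).differentiableAt (hU.mem_nhds hx)
    have hdg : DifferentiableAt ℝ (mderiv ℓ g) x :=
      ((mderiv_contDiffOn ℓ hU hg).differentiableOn (by simp)).differentiableAt (hU.mem_nhds hx)
    simp only [mderiv]
    rw [h1.fderiv_eq, fderiv_fun_sub hdf hdg]
    rfl

lemma mderiv_tsupport {d : ℕ} (ℓ : List (Fin d)) (f : (Fin d → ℝ) → ℝ) :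
    tsupport (mderiv ℓ f) ⊆ tsupport f := by
  induction ℓ with
  | nil => exact subset_rfl
  | cons i ℓ ih =>
    refine subset_trans ?_ ((tsupport_fderiv_subset ℝ (f := mderiv ℓ f)).trans ih)
    refine closure_mono ?_
    intro x hx
    simp only [Function.mem_support, mderiv] at hx ⊢
    intro h
    exact hx (by rw [h]; rfl)

lemma mderiv_hasCompactSupport {d : ℕ} (ℓ : List (Fin d)) {f : (Fin d → ℝ) → ℝ}
    (hf : HasCompactSupport f) : HasCompactSupport (mderiv ℓ f) :=
  hf.of_isClosed_subset (isClosed_tsupport _) (mderiv_tsupport ℓ f)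

open scoped Convolution in
lemma mderiv_conv {d : ℕ} (ℓ : List (Fin d)) {f g : (Fin d → ℝ) → ℝ}
    (hf : LocallyIntegrable f volume) (hg : ContDiff ℝ (⊤ : ℕ∞) g) (hgc : HasCompactSupport g) :
    mderiv ℓ (fun z => ∫ y, f y * g (z - y)) = fun z => ∫ y, f y * mderiv ℓ g (z - y) := by
  induction ℓ with
  | nil => rfl
  | cons i ℓ ih =>
    funext x
    simp only [mderiv]
    rw [ih]
    have hc := mderiv_hasCompactSupport ℓ hgc
    have hs := mderiv_contDiff ℓ hg
    have hs1 : ContDiff ℝ 1 (mderiv ℓ g) := hs.of_le (by exact_mod_cast le_top)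
    have h := hc.hasFDerivAt_convolution_right (ContinuousLinearMap.mul ℝ ℝ) hf hs1 x
    have h' : HasFDerivAt (fun z => ∫ y, f y * mderiv ℓ g (z - y)) _ x := h
    rw [h'.fderiv, convolution_precompR_apply _ hf (hc.fderiv ℝ)
      (hs1.continuous_fderiv one_ne_zero)]
    rfl

/-- Diagonal scaling as a continuous linear equivalence. -/
noncomputable def dil {d : ℕ} (s : Fin d → ℕ) (ε : ℝ) (hε : 0 < ε) :
    (Fin d → ℝ) ≃L[ℝ] (Fin d → ℝ) :=
  ContinuousLinearEquiv.piCongrRight fun i =>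
    ContinuousLinearEquiv.unitsEquivAut ℝ (Units.mk0 (ε ^ s i) (pow_ne_zero _ hε.ne'))

lemma dil_apply {d : ℕ} (s : Fin d → ℕ) (ε : ℝ) (hε : 0 < ε) (x : Fin d → ℝ) :
    dil s ε hε x = fun i => ε ^ s i * x i := by
  funext i
  simp [dil, mul_comm]

lemma mderiv_dil {d : ℕ} (s : Fin d → ℕ) (ε : ℝ) (hε : 0 < ε) (ℓ : List (Fin d))
    (f : (Fin d → ℝ) → ℝ) :
    mderiv ℓ (fun x => f (dil s ε hε x)) = fun x => ε ^ sdeg s ℓ * mderiv ℓ f (dil s ε hε x) := by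
  induction ℓ with
  | nil => funext x; simp [mderiv, sdeg]
  | cons i ℓ ih =>
    funext x
    simp only [mderiv]
    rw [ih]
    have h1 : (fun x => ε ^ sdeg s ℓ * mderiv ℓ f (dil s ε hε x))
      = (ε ^ sdeg s ℓ) • (mderiv ℓ f ∘ (dil s ε hε)) := rfl
    rw [h1, fderiv_const_smul_field, Pi.smul_apply, ContinuousLinearEquiv.comp_right_fderiv]
    have h2 : dil s ε hε (Pi.single i 1) = (ε ^ s i) • Pi.single i 1 := by
      rw [dil_apply]
      funext j
      by_cases h : j = i
      · subst h; simp
      · simp [h]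
    simp only [ContinuousLinearMap.smul_apply, ContinuousLinearMap.comp_apply,
      ContinuousLinearEquiv.coe_coe, h2, map_smul, smul_eq_mul, sdeg, List.map_cons, List.sum_cons,
      pow_add]
    ring

lemma integral_dil {d : ℕ} (s : Fin d → ℕ) (ε : ℝ) (hε : 0 < ε) (F : (Fin d → ℝ) → ℝ) :
    ∫ y, F y = ε ^ (∑ i, s i) * ∫ y, F (dil s ε hε y) := by
  have hdet : (Matrix.diagonal fun i => ε ^ s i : Matrix (Fin d) (Fin d) ℝ).det
      = ε ^ (∑ i, s i) := by
    rw [Matrix.det_diagonal, Finset.prod_pow_eq_pow_sum]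
  have hpos : 0 < ε ^ (∑ i, s i) := pow_pos hε _
  have h := Real.smul_map_diagonal_volume_pi (D := fun i => ε ^ s i) (by rw [hdet]; exact hpos.ne')
  have hfun : ⇑(Matrix.toLin' (Matrix.diagonal fun i => ε ^ s i : Matrix (Fin d) (Fin d) ℝ))
      = dil s ε hε := by
    funext x
    rw [dil_apply]
    funext i
    simp [Matrix.mulVec_diagonal]
  rw [hfun, hdet, abs_of_pos hpos] at h
  conv_lhs => rw [← h]
  rw [integral_smul_measure, ENNReal.toReal_ofReal hpos.le, smul_eq_mul]
  congr 1
  exact ((dil s ε hε).toHomeomorph.measurableEmbedding.integral_map F)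

/-! ### The scaled norm -/

lemma sNorm_nonneg {d : ℕ} (s : Fin d → ℕ) (x : Fin d → ℝ) : 0 ≤ sNorm s x :=
  Finset.sum_nonneg fun i _ => Real.rpow_nonneg (abs_nonneg _) _

lemma sNorm_coord {d : ℕ} (s : Fin d → ℕ) (x : Fin d → ℝ) (i : Fin d) :
    |x i| ^ ((s i : ℝ)⁻¹) ≤ sNorm s x :=
  Finset.single_le_sum (f := fun i => |x i| ^ ((s i : ℝ)⁻¹))
    (fun i _ => Real.rpow_nonneg (abs_nonneg _) _) (Finset.mem_univ i)

lemma sNorm_pos {d : ℕ} (s : Fin d → ℕ) {x : Fin d → ℝ} (hx : x ≠ 0) : 0 < sNorm s x := by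
  obtain ⟨i, hi⟩ := Function.ne_iff.1 hx
  exact (Real.rpow_pos_of_pos (abs_pos.2 hi) _).trans_le (sNorm_coord s x i)

lemma sNorm_add_le {d : ℕ} (s : Fin d → ℕ) (hs : ∀ i, 0 < s i) (x y : Fin d → ℝ) :
    sNorm s (x + y) ≤ sNorm s x + sNorm s y := by
  unfold sNorm
  rw [← Finset.sum_add_distrib]
  refine Finset.sum_le_sum fun i _ => ?_
  have h1 : (1 : ℝ) ≤ s i := by exact_mod_cast hs i
  refine le_trans (Real.rpow_le_rpow (abs_nonneg _) (abs_add_le _ _) (by positivity)) ?_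
  exact Real.rpow_add_le_add_rpow (abs_nonneg _) (abs_nonneg _) (by positivity)
    (inv_le_one_of_one_le₀ h1)

lemma sNorm_dil {d : ℕ} (s : Fin d → ℕ) (hs : ∀ i, 0 < s i) (ε : ℝ) (hε : 0 < ε)
    (x : Fin d → ℝ) : sNorm s (dil s ε hε x) = ε * sNorm s x := by
  rw [dil_apply]
  unfold sNorm
  rw [Finset.mul_sum]
  refine Finset.sum_congr rfl fun i _ => ?_
  rw [abs_mul, abs_of_pos (pow_pos hε _), Real.mul_rpow (pow_pos hε _).le (abs_nonneg _),
    Real.pow_rpow_inv_natCast hε.le (hs i).ne']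

/-- If all coordinates are at most `R` with `R ≥ 1`, then the scaled norm is at most `d R`. -/
lemma sNorm_le_of_coord {d : ℕ} (s : Fin d → ℕ) (hs : ∀ i, 0 < s i) {R : ℝ} (hR : 1 ≤ R)
    {x : Fin d → ℝ} (hx : ∀ i, |x i| ≤ R) : sNorm s x ≤ d * R := by
  unfold sNorm
  have : ∀ i ∈ (Finset.univ : Finset (Fin d)), |x i| ^ ((s i : ℝ)⁻¹) ≤ R := by
    intro i _
    have h1 : (1 : ℝ) ≤ s i := by exact_mod_cast hs i
    refine le_trans (Real.rpow_le_rpow (abs_nonneg _) (hx i) (by positivity)) ?_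
    exact Real.rpow_le_self_of_one_le hR (inv_le_one_of_one_le₀ h1)
  refine (Finset.sum_le_sum this).trans ?_
  simp

/-- Bound of the coordinates by the scaled norm. -/
lemma coord_le_of_sNorm {d : ℕ} (s : Fin d → ℕ) (hs : ∀ i, 0 < s i) {A : ℝ} (hA : 1 ≤ A)
    {x : Fin d → ℝ} (hx : sNorm s x ≤ A) (i : Fin d) : |x i| ≤ A ^ (Finset.univ.sup s) := by
  have h := (sNorm_coord s x i).trans hx
  have h2 : |x i| ≤ A ^ s i := by
    have := pow_le_pow_left₀ (Real.rpow_nonneg (abs_nonneg _) _) h (s i)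
    rwa [Real.rpow_inv_natCast_pow (abs_nonneg _) (hs i).ne'] at this
  exact h2.trans (pow_le_pow_right₀ hA (Finset.le_sup (Finset.mem_univ i)))

/-! ### Integrability -/

lemma integrableOn_abs_rpow {a : ℝ} (ha : -1 < a) (L : ℝ) (hL : 0 ≤ L) :
    IntegrableOn (fun x : ℝ => |x| ^ a) (Set.Icc (-L) L) := by
  have h0 : IntegrableOn (fun x : ℝ => |x| ^ a) (Set.Icc 0 L) := by
    have := (intervalIntegrable_iff_integrableOn_Icc_of_le hL).1
      (intervalIntegral.intervalIntegrable_rpow' ha (a := 0) (b := L))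
    refine this.congr_fun ?_ measurableSet_Icc
    intro x hx
    simp [abs_of_nonneg hx.1]
  have h1 : IntegrableOn (fun x : ℝ => |x| ^ a) (Set.Icc (-L) 0) := by
    have h2 := h0.comp_neg
    simpa using h2
  have := h1.union h0
  rwa [Set.Icc_union_Icc_eq_Icc (by linarith) hL] at this


lemma integrableOn_prod_abs_rpow {d : ℕ} {a : ℝ} (ha : -1 < a) (L : ℝ) (hL : 0 ≤ L) :
    IntegrableOn (fun t : Fin d → ℝ => ∏ i, |t i| ^ a) (Metric.closedBall 0 L) := by
  have h1 : Metric.closedBall (0 : Fin d → ℝ) L = Set.univ.pi fun _ => Set.Icc (-L) L := by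
    rw [closedBall_pi _ hL]
    simp [Real.closedBall_eq_Icc]
  rw [h1, IntegrableOn, volume_pi, Measure.restrict_pi_pi]
  exact Integrable.fintype_prod (f := fun (_ : Fin d) (x : ℝ) => |x| ^ a)
    (μ := fun _ => volume.restrict (Set.Icc (-L) L))
    fun i => integrableOn_abs_rpow ha L hL

lemma sNorm_rpow_le_prod {d : ℕ} (s : Fin d → ℕ) (hs : ∀ i, 0 < s i) {ζ a : ℝ}
    (ha : ζ = ∑ i, (s i : ℝ) * a) (ha0 : a ≤ 0) {t : Fin d → ℝ} (ht0 : t ≠ 0)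
    (ht : ∀ i, t i ≠ 0) : sNorm s t ^ ζ ≤ ∏ i, |t i| ^ a := by
  have hp := sNorm_pos s ht0
  rw [ha, Real.rpow_sum_of_pos hp]
  refine Finset.prod_le_prod (fun i _ => Real.rpow_nonneg hp.le _) fun i _ => ?_
  have hsi : (0 : ℝ) < s i := by exact_mod_cast hs i
  have hti : 0 < |t i| := abs_pos.2 (ht i)
  have := Real.rpow_le_rpow_of_nonpos (Real.rpow_pos_of_pos hti _) (sNorm_coord s t i)
    (mul_nonpos_of_nonneg_of_nonpos hsi.le ha0)
  rwa [← Real.rpow_mul hti.le, inv_mul_cancel_left₀ hsi.ne'] at this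

lemma ae_coord_ne {d : ℕ} : ∀ᵐ t : Fin d → ℝ, ∀ i, t i ≠ 0 := by
  rw [ae_all_iff]
  intro i
  rw [volume_pi]
  exact Measure.ae_eval_ne (μ := fun _ => volume) i 0

/-- Pointwise a.e. bound of the kernel. -/
lemma kernel_ae_bound {d : ℕ} [Nonempty (Fin d)] (s : Fin d → ℕ) (hs : ∀ i, 0 < s i) {ζ a N : ℝ}
    (ha : ζ = ∑ i, (s i : ℝ) * a) (ha0 : a ≤ 0) (hN : 0 ≤ N) {K : (Fin d → ℝ) → ℝ}
    (hb : ∀ x : Fin d → ℝ, x ≠ 0 → |K x| ≤ N * sNorm s x ^ ζ) :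
    ∀ᵐ t : Fin d → ℝ, |K t| ≤ N * ∏ i, |t i| ^ a := by
  filter_upwards [ae_coord_ne] with t ht
  have ht0 : t ≠ 0 := by
    rintro rfl
    exact ht (Classical.arbitrary _) rfl
  exact (hb t ht0).trans (mul_le_mul_of_nonneg_left (sNorm_rpow_le_prod s hs ha ha0 ht0 ht) hN)

lemma kernel_locallyIntegrable {d : ℕ} [Nonempty (Fin d)] {a N : ℝ} (ha1 : -1 < a)
    {K : (Fin d → ℝ) → ℝ} (hK : ContinuousOn K {x | x ≠ 0})
    (hb : ∀ᵐ t : Fin d → ℝ, |K t| ≤ N * ∏ i, |t i| ^ a) : LocallyIntegrable K volume := by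
  have hm : AEStronglyMeasurable K volume := by
    rw [← restrict_compl_singleton (μ := (volume : Measure (Fin d → ℝ))) 0]
    exact ContinuousOn.aestronglyMeasurable hK (measurableSet_singleton _).compl
  rw [locallyIntegrable_iff]
  intro k hk
  obtain ⟨L, hL⟩ := hk.isBounded.subset_closedBall 0
  have hL' : k ⊆ Metric.closedBall 0 (max L 0) :=
    hL.trans (Metric.closedBall_subset_closedBall (le_max_left _ _))
  have h1 := integrableOn_prod_abs_rpow (d := d) ha1 (max L 0) (le_max_right _ _)
  refine IntegrableOn.mono_set ?_ hL'
  exact Integrable.mono' (h1.const_mul N) hm.restrict (ae_restrict_of_ae hb)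

/-- Smooth cutoff of the singularity at the origin. -/
lemma exists_cutoff {d : ℕ} {K : (Fin d → ℝ) → ℝ} (hK : ContDiffOn ℝ (⊤ : ℕ∞) K {x | x ≠ 0})
    (hKc : HasCompactSupport K) :
    ∃ K2 : (Fin d → ℝ) → ℝ, ContDiff ℝ (⊤ : ℕ∞) K2 ∧ HasCompactSupport K2 ∧
      ∀ y : Fin d → ℝ, 1 < ‖y‖ → K2 y = K y := by
  let χ : ContDiffBump (0 : Fin d → ℝ) := ⟨1 / 2, 1, by norm_num, by norm_num⟩
  refine ⟨fun y => (1 - χ y) * K y, ?_, ?_, ?_⟩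
  · rw [contDiff_iff_contDiffAt]
    intro x
    by_cases hx : x = 0
    · subst hx
      have : (fun y => (1 - χ y) * K y) =ᶠ[nhds 0] fun _ => 0 := by
        filter_upwards [Metric.closedBall_mem_nhds (0 : Fin d → ℝ) (ε := 1 / 2) (by norm_num)]
          with y hy
        rw [χ.one_of_mem_closedBall hy]
        simp
      exact contDiffAt_const.congr_of_eventuallyEq this
    · have h1 : ContDiffAt ℝ (⊤ : ℕ∞) K x := hK.contDiffAt (isOpen_ne.mem_nhds hx)
      exact (contDiffAt_const.sub χ.contDiffAt).mul h1
  · exact hKc.mul_left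
  · intro y hy
    have : χ y = 0 := χ.zero_of_le_dist (by rw [dist_zero_right]; exact hy.le)
    simp [this]


/-- The difference of values of a derivative away from the origin. -/
lemma far_diff {d : ℕ} [Nonempty (Fin d)] (s : Fin d → ℕ) (hs : ∀ i, 0 < s i) {ζ ζ' : ℝ}
    (hζ₂ : ζ < 0) (hζ' : ζ - 1 ≤ ζ') (ℓ : List (Fin d)) {R : ℝ} (hR : 1 ≤ R)
    {K K2 : (Fin d → ℝ) → ℝ} {N : ℝ} (hN : 0 ≤ N) (hK2 : ContDiff ℝ (⊤ : ℕ∞) K2)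
    (hK2e : ∀ y : Fin d → ℝ, 1 < ‖y‖ → K2 y = K y)
    (hb : ∀ i, ∀ x : Fin d → ℝ, x ≠ 0 →
        |mderiv (i :: ℓ) K x| ≤ N * sNorm s x ^ (ζ - (sdeg s (i :: ℓ) : ℝ)))
    {x u : Fin d → ℝ} (hx : 4 * (d * R) ≤ sNorm s x) (hu : ∀ i, |u i| ≤ R) :
    |mderiv ℓ K2 x - mderiv ℓ K2 (x - u)| ≤
      d * (R * (N * (2 ^ ((Finset.univ.sup s : ℕ) + (sdeg s ℓ : ℝ) - ζ) *
        sNorm s x ^ (ζ' - (sdeg s ℓ : ℝ))))) := by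
  have hd : (1 : ℝ) ≤ d := by
    have : 0 < d := Fin.pos_iff_nonempty.2 inferInstance
    exact_mod_cast this
  have hdR : (d : ℝ) ≤ d * R := le_mul_of_one_le_right (by linarith) hR
  have hSx1 : 1 ≤ sNorm s x := by linarith
  have hf := mderiv_contDiff ℓ hK2
  have hder : ∀ t : ℝ, HasDerivAt (fun t : ℝ => mderiv ℓ K2 (x - t • u))
      (fderiv ℝ (mderiv ℓ K2) (x - t • u) (-u)) t := by
    intro t
    have h1 : HasDerivAt (fun t : ℝ => x - t • u) (-u) t := by
      have := ((hasDerivAt_id t).smul_const u).const_sub x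
      simpa using this
    exact ((hf.differentiable (by simp)) (x - t • u)).hasFDerivAt.comp_hasDerivAt t h1
  have hbound : ∀ t ∈ Set.Ico (0 : ℝ) 1, ‖fderiv ℝ (mderiv ℓ K2) (x - t • u) (-u)‖ ≤
      d * (R * (N * (2 ^ ((Finset.univ.sup s : ℕ) + (sdeg s ℓ : ℝ) - ζ) *
        sNorm s x ^ (ζ' - (sdeg s ℓ : ℝ))))) := by
    intro t ht
    set y := x - t • u with hy
    have htu : sNorm s (t • u) ≤ d * R := by
      refine sNorm_le_of_coord s hs hR fun i => ?_
      simp only [Pi.smul_apply, smul_eq_mul, abs_mul, abs_of_nonneg ht.1]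
      exact (mul_le_of_le_one_left (abs_nonneg _) ht.2.le).trans (hu i)
    have htri : sNorm s x ≤ sNorm s y + sNorm s (t • u) := by
      have := sNorm_add_le s hs y (t • u)
      simpa [hy] using this
    have hy2 : sNorm s x / 2 ≤ sNorm s y := by linarith
    have hy1 : 1 < ‖y‖ := by
      by_contra! hcon
      have := sNorm_le_of_coord s hs le_rfl (x := y) fun i => (norm_le_pi_norm y i).trans hcon
      linarith
    have hy0 : y ≠ 0 := by
      rintro h
      rw [h, norm_zero] at hy1
      linarith
    have hdec : -u = ∑ i, (-u i) • (Pi.single i (1 : ℝ) : Fin d → ℝ) := by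
      funext j
      simp [Finset.sum_apply, Pi.single_apply]
    rw [hdec, map_sum]
    refine (norm_sum_le _ _).trans ?_
    have hterm : ∀ i ∈ (Finset.univ : Finset (Fin d)),
        ‖fderiv ℝ (mderiv ℓ K2) y ((-u i) • (Pi.single i (1 : ℝ) : Fin d → ℝ))‖ ≤
        (R * (N * (2 ^ ((Finset.univ.sup s : ℕ) + (sdeg s ℓ : ℝ) - ζ) *
        sNorm s x ^ (ζ' - (sdeg s ℓ : ℝ))))) := by
      intro i _
      rw [map_smul, norm_smul, norm_neg]
      have he : mderiv (i :: ℓ) K2 y = mderiv (i :: ℓ) K y := by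
        refine (mderiv_congr (i :: ℓ) ?_).eq_of_nhds
        filter_upwards [(isOpen_lt continuous_const continuous_norm).mem_nhds hy1] with z hz
        exact hK2e z hz
      have he' : fderiv ℝ (mderiv ℓ K2) y (Pi.single i 1) = mderiv (i :: ℓ) K y := he
      rw [he', Real.norm_eq_abs, Real.norm_eq_abs]
      refine mul_le_mul (hu i) ?_ (abs_nonneg _) (by linarith)
      refine (hb i y hy0).trans (mul_le_mul_of_nonneg_left ?_ hN)
      have hsi : (1 : ℝ) ≤ s i := by exact_mod_cast hs i
      have hsM : (s i : ℝ) ≤ (Finset.univ.sup s : ℕ) := by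
        exact_mod_cast Finset.le_sup (f := s) (Finset.mem_univ i)
      have hdeg : ((sdeg s (i :: ℓ) : ℕ) : ℝ) = s i + sdeg s ℓ := by
        simp [sdeg]
      have hl0 : (0 : ℝ) ≤ sdeg s ℓ := Nat.cast_nonneg _
      rw [hdeg]
      have hneg : ζ - (s i + sdeg s ℓ : ℝ) ≤ 0 := by linarith
      calc sNorm s y ^ (ζ - (s i + sdeg s ℓ : ℝ))
          ≤ (sNorm s x / 2) ^ (ζ - (s i + sdeg s ℓ : ℝ)) :=
            Real.rpow_le_rpow_of_nonpos (by linarith) hy2 hneg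
        _ = 2 ^ (-(ζ - (s i + sdeg s ℓ : ℝ))) * sNorm s x ^ (ζ - (s i + sdeg s ℓ : ℝ)) := by
            rw [Real.div_rpow (by linarith) (by norm_num), Real.rpow_neg (by norm_num)]
            field_simp
        _ ≤ _ := by
            refine mul_le_mul (Real.rpow_le_rpow_of_exponent_le (by norm_num) (by linarith))
              (Real.rpow_le_rpow_of_exponent_le hSx1 (by linarith)) (by positivity) (by positivity)
    refine (Finset.sum_le_sum hterm).trans ?_
    simp
  have := norm_image_sub_le_of_norm_deriv_le_segment_01'
    (f := fun t : ℝ => mderiv ℓ K2 (x - t • u)) (fun t _ => (hder t).hasDerivWithinAt) hbound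
  simp only [one_smul, zero_smul, sub_zero, Real.norm_eq_abs] at this
  rwa [abs_sub_comm] at this

/-- The bound away from the origin. -/
lemma far_bound {d : ℕ} [Nonempty (Fin d)] (s : Fin d → ℕ) (hs : ∀ i, 0 < s i) {ζ ζ' : ℝ}
    (hζ₂ : ζ < 0) (hζ' : ζ - 1 ≤ ζ')
    {ρ : (Fin d → ℝ) → ℝ} (hρ : ContDiff ℝ (⊤ : ℕ∞) ρ) (hρc : HasCompactSupport ρ)
    (hρ1 : (∫ y, ρ y) = 1) (ℓ : List (Fin d)) {R : ℝ} (hR : 1 ≤ R)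
    (hρR : ∀ u, ρ u ≠ 0 → ∀ i, |u i| ≤ R)
    {K : (Fin d → ℝ) → ℝ} {N : ℝ} (hN : 0 ≤ N) (hK : ContDiffOn ℝ (⊤ : ℕ∞) K {x | x ≠ 0})
    (hKc : HasCompactSupport K)
    (hb : ∀ i, ∀ x : Fin d → ℝ, x ≠ 0 →
        |mderiv (i :: ℓ) K x| ≤ N * sNorm s x ^ (ζ - (sdeg s (i :: ℓ) : ℝ)))
    {x : Fin d → ℝ} (hx : 4 * (d * R) ≤ sNorm s x) :
    |mderiv ℓ K x - mderiv ℓ (fun z => ∫ y, ρ (z - y) * K y) x| ≤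
      (∫ u, |ρ u|) * (d * (R * (N * (2 ^ ((Finset.univ.sup s : ℕ) + (sdeg s ℓ : ℝ) - ζ) *
        sNorm s x ^ (ζ' - (sdeg s ℓ : ℝ)))))) := by
  have hd : (1 : ℝ) ≤ d := by
    have : 0 < d := Fin.pos_iff_nonempty.2 inferInstance
    exact_mod_cast this
  have hdR : (d : ℝ) ≤ d * R := le_mul_of_one_le_right (by linarith) hR
  obtain ⟨K2, hK2, hK2c, hK2e⟩ := exists_cutoff hK hKc
  have hlarge : ∀ y : Fin d → ℝ, d < sNorm s y → 1 < ‖y‖ := by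
    intro y hy
    by_contra! hcon
    have := sNorm_le_of_coord s hs le_rfl (x := y) fun i => (norm_le_pi_norm y i).trans hcon
    linarith
  have hx1 : 1 < ‖x‖ := hlarge x (by linarith)
  have e1 : mderiv ℓ K x = mderiv ℓ K2 x := by
    refine (mderiv_congr ℓ ?_).eq_of_nhds
    filter_upwards [(isOpen_lt continuous_const continuous_norm).mem_nhds hx1] with z hz
    exact (hK2e z hz).symm
  have e2 : (fun z => ∫ y, ρ (z - y) * K y) =ᶠ[nhds x] fun z => ∫ y, ρ y * K2 (z - y) := by
    filter_upwards [Metric.closedBall_mem_nhds x one_pos] with z hz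
    rw [← integral_sub_left_eq_self _ _ z]
    refine integral_congr_ae (Filter.Eventually.of_forall fun u => ?_)
    simp only [sub_sub_cancel]
    by_cases hu : ρ u = 0
    · simp [hu]
    · congr 1
      symm
      apply hK2e
      apply hlarge
      have h1 := sNorm_le_of_coord s hs hR (hρR u hu)
      have h2 : sNorm s (x - z) ≤ d * R := by
        refine sNorm_le_of_coord s hs hR fun i => ?_
        refine (norm_le_pi_norm (x - z) i).trans (le_trans ?_ hR)
        rw [← dist_eq_norm, dist_comm]
        exact hz
      have h3 := sNorm_add_le s hs (z - u) u
      have h4 := sNorm_add_le s hs (x - z) z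
      rw [sub_add_cancel] at h3 h4
      linarith
  have hρi : Integrable ρ := hρ.continuous.integrable_of_hasCompactSupport hρc
  rw [e1, (mderiv_congr ℓ e2).eq_of_nhds, mderiv_conv ℓ hρi.locallyIntegrable hK2 hK2c]
  have hf := (mderiv_contDiff ℓ hK2).continuous
  have e3 : mderiv ℓ K2 x = ∫ u, ρ u * mderiv ℓ K2 x := by
    rw [integral_mul_const, hρ1, one_mul]
  have hi2 : Integrable (fun u => ρ u * mderiv ℓ K2 (x - u)) := by
    refine Continuous.integrable_of_hasCompactSupport ?_ hρc.mul_right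
    exact hρ.continuous.mul (hf.comp (continuous_const.sub continuous_id))
  simp only
  conv_lhs => rw [e3]
  rw [← integral_sub (hρi.mul_const _) hi2, ← integral_mul_const, ← Real.norm_eq_abs]
  refine norm_integral_le_of_norm_le (hρi.abs.mul_const _) (Filter.Eventually.of_forall fun u => ?_)
  rw [← mul_sub, norm_mul, Real.norm_eq_abs, Real.norm_eq_abs]
  by_cases hu : ρ u = 0
  · simp [hu]
  · exact mul_le_mul_of_nonneg_left
      (far_diff s hs hζ₂ hζ' ℓ hR hN hK2 hK2e hb hx (hρR u hu)) (abs_nonneg _)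

/-- The bound of the mollified kernel close to the origin. -/
lemma near_bound {d : ℕ} {a N R A Mρ : ℝ} (ha1 : -1 < a)
    {ρ : (Fin d → ℝ) → ℝ} (hρ : ContDiff ℝ (⊤ : ℕ∞) ρ) (hρc : HasCompactSupport ρ)
    (ℓ : List (Fin d)) (hR : 1 ≤ R) (hA : 0 ≤ A)
    (hρR : tsupport ρ ⊆ Metric.closedBall 0 R)
    (hM : ∀ u, |mderiv ℓ ρ u| ≤ Mρ)
    {K : (Fin d → ℝ) → ℝ} (hKl : LocallyIntegrable K volume)
    (hb : ∀ᵐ t : Fin d → ℝ, |K t| ≤ N * ∏ i, |t i| ^ a)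
    {x : Fin d → ℝ} (hx : ‖x‖ ≤ A) :
    |mderiv ℓ (fun z => ∫ y, ρ (z - y) * K y) x| ≤
      Mρ * N * ∫ t in Metric.closedBall (0 : Fin d → ℝ) (A + R), ∏ i, |t i| ^ a := by
  have e1 : (fun z => ∫ y, ρ (z - y) * K y) = fun z => ∫ y, K y * ρ (z - y) := by
    funext z
    simp only [mul_comm]
  rw [e1, mderiv_conv ℓ hKl hρ hρc]
  simp only
  have hz : ∀ y, y ∉ Metric.closedBall (0 : Fin d → ℝ) (A + R) →
      K y * mderiv ℓ ρ (x - y) = 0 := by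
    intro y hy
    have : mderiv ℓ ρ (x - y) = 0 := by
      refine image_eq_zero_of_notMem_tsupport fun h => hy ?_
      have h1 := hρR (mderiv_tsupport ℓ ρ h)
      rw [mem_closedBall_zero_iff] at h1 ⊢
      have h2 := norm_sub_le x (x - y)
      rw [sub_sub_cancel] at h2
      linarith
    rw [this, mul_zero]
  rw [← setIntegral_eq_integral_of_forall_compl_eq_zero hz, ← integral_const_mul,
    ← Real.norm_eq_abs]
  refine norm_integral_le_of_norm_le
    ((integrableOn_prod_abs_rpow ha1 (A + R) (by linarith)).const_mul _) (ae_restrict_of_ae ?_)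
  filter_upwards [hb] with t ht
  rw [norm_mul, Real.norm_eq_abs, Real.norm_eq_abs]
  calc |K t| * |mderiv ℓ ρ (x - t)| ≤ (N * ∏ i, |t i| ^ a) * Mρ :=
        mul_le_mul ht (hM _) (abs_nonneg _) ((abs_nonneg _).trans ht)
    _ = _ := by ring

open scoped Convolution in
lemma conv_contDiff {d : ℕ} {ρ K : (Fin d → ℝ) → ℝ} (hρ : ContDiff ℝ (⊤ : ℕ∞) ρ)
    (hρc : HasCompactSupport ρ) (hKl : LocallyIntegrable K volume) :
    ContDiff ℝ (⊤ : ℕ∞) (fun z => ∫ y, ρ (z - y) * K y) := by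
  have e1 : (fun z => ∫ y, ρ (z - y) * K y) = fun z => ∫ y, K y * ρ (z - y) := by
    funext z
    simp only [mul_comm]
  rw [e1]
  exact hρc.contDiff_convolution_right (ContinuousLinearMap.mul ℝ ℝ) hKl hρ


/-- The case `ε = 1`, for a fixed multiindex. -/
lemma unit_bound {d : ℕ} [Nonempty (Fin d)] (s : Fin d → ℕ) (hs : ∀ i, 0 < s i) {ζ ζ' : ℝ}
    (hζ₁ : -(∑ i, (s i : ℝ)) < ζ) (hζ₂ : ζ < 0) (hζ' : ζ' ∈ Set.Ico (ζ - 1) ζ)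
    {ρ : (Fin d → ℝ) → ℝ} (hρ : ContDiff ℝ (⊤ : ℕ∞) ρ) (hρc : HasCompactSupport ρ)
    (hρ1 : (∫ y, ρ y) = 1) (ℓ : List (Fin d)) :
    ∃ C : ℝ, 0 ≤ C ∧ ∀ (K : (Fin d → ℝ) → ℝ) (N : ℝ), 0 ≤ N →
      ContDiffOn ℝ (⊤ : ℕ∞) K {x | x ≠ 0} → HasCompactSupport K →
      (∀ ℓ' : List (Fin d), sdeg s ℓ' ≤ sdeg s ℓ + Finset.univ.sup s → ∀ x : Fin d → ℝ, x ≠ 0 →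
        |mderiv ℓ' K x| ≤ N * sNorm s x ^ (ζ - (sdeg s ℓ' : ℝ))) →
      ∀ x : Fin d → ℝ, x ≠ 0 →
        |mderiv ℓ (fun z => K z - ∫ y, ρ (z - y) * K y) x|
          ≤ C * N * sNorm s x ^ (ζ' - (sdeg s ℓ : ℝ)) := by
  have hd : (1 : ℝ) ≤ d := by
    have : 0 < d := Fin.pos_iff_nonempty.2 inferInstance
    exact_mod_cast this
  obtain ⟨R', hR'⟩ := hρc.isCompact.isBounded.subset_closedBall 0
  set R := max R' 1 with hRdef
  have hR : 1 ≤ R := le_max_right _ _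
  have hρR : tsupport ρ ⊆ Metric.closedBall 0 R :=
    hR'.trans (Metric.closedBall_subset_closedBall (le_max_left _ _))
  have hρR' : ∀ u, ρ u ≠ 0 → ∀ i, |u i| ≤ R := by
    intro u hu i
    have := hρR (subset_tsupport ρ hu)
    rw [mem_closedBall_zero_iff] at this
    exact (norm_le_pi_norm u i).trans this
  obtain ⟨Mρ, hM⟩ := (mderiv_contDiff ℓ hρ).continuous.bounded_above_of_compact_support
    (mderiv_hasCompactSupport ℓ hρc)
  have hM0 : 0 ≤ Mρ := (norm_nonneg _).trans (hM 0)
  have hS : 0 < ∑ i, (s i : ℝ) :=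
    Finset.sum_pos (fun i _ => by exact_mod_cast hs i) Finset.univ_nonempty
  set a := ζ / ∑ i, (s i : ℝ) with ha
  have ha1 : -1 < a := by
    rw [ha, lt_div_iff₀ hS]
    linarith
  have ha0 : a ≤ 0 := div_nonpos_of_nonpos_of_nonneg hζ₂.le hS.le
  have haζ : ζ = ∑ i, (s i : ℝ) * a := by
    rw [← Finset.sum_mul, ha, mul_div_cancel₀ _ hS.ne']
  set A := 4 * ((d : ℝ) * R) with hAdef
  have hA1 : 1 ≤ A := by nlinarith
  set I := ∫ t in Metric.closedBall (0 : Fin d → ℝ) (A ^ (Finset.univ.sup s) + R), ∏ i, |t i| ^ a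
    with hI
  have hI0 : 0 ≤ I := integral_nonneg fun t =>
    Finset.prod_nonneg fun i _ => Real.rpow_nonneg (abs_nonneg _) _
  set C1 := A ^ (ζ - ζ') with hC1
  set C2 := Mρ * I * A ^ ((sdeg s ℓ : ℝ) - ζ') with hC2
  set B0 : ℝ := 2 ^ ((Finset.univ.sup s : ℕ) + (sdeg s ℓ : ℝ) - ζ) with hB0
  set C3 := (∫ u, |ρ u|) * (d * (R * B0)) with hC3
  have hA0 : 0 < A := by linarith
  have hC1' : 0 ≤ C1 := by positivity
  have hC2' : 0 ≤ C2 := by positivity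
  have hC3' : 0 ≤ C3 := by
    have : 0 ≤ ∫ u, |ρ u| := integral_nonneg fun u => abs_nonneg _
    have hR0 : 0 ≤ R := by linarith
    positivity
  refine ⟨C1 + C2 + C3, by positivity, ?_⟩
  intro K N hN hK hKc hb x hx
  have hb0 : ∀ x : Fin d → ℝ, x ≠ 0 → |K x| ≤ N * sNorm s x ^ ζ := by
    intro x hx
    have := hb [] (by simp [sdeg]) x hx
    simpa [mderiv, sdeg] using this
  have hae := kernel_ae_bound s hs haζ ha0 hN hb0
  have hKl := kernel_locallyIntegrable ha1 hK.continuousOn hae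
  have hcs := conv_contDiff hρ hρc hKl
  rw [mderiv_sub ℓ isOpen_ne hK hcs.contDiffOn x hx]
  have hSx := sNorm_pos s hx
  set P := sNorm s x ^ (ζ' - (sdeg s ℓ : ℝ)) with hP
  have hP0 : 0 ≤ P := by positivity
  have hl0 : (0 : ℝ) ≤ sdeg s ℓ := Nat.cast_nonneg _
  rcases le_total A (sNorm s x) with hfar | hnear
  · have h := far_bound s hs hζ₂ hζ'.1 hρ hρc hρ1 ℓ hR hρR' hN hK hKc
      (fun i => hb (i :: ℓ) (by
        have := Finset.le_sup (f := s) (Finset.mem_univ i)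
        simp only [sdeg, List.map_cons, List.sum_cons]
        omega)) hfar
    refine h.trans ?_
    have : (∫ u, |ρ u|) * (d * (R * (N * (B0 * P)))) = C3 * N * P := by rw [hC3]; ring
    rw [this]
    have h1 : 0 ≤ N * P := by positivity
    nlinarith [mul_nonneg hC1' h1, mul_nonneg hC2' h1]
  · have hxn : ‖x‖ ≤ A ^ (Finset.univ.sup s) := by
      rw [pi_norm_le_iff_of_nonneg (by positivity)]
      exact fun i => coord_le_of_sNorm s hs hA1 hnear i
    have h2 := near_bound ha1 hρ hρc ℓ hR (by positivity) hρR hM hKl hae hxn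
    have h1 := hb ℓ (by omega) x hx
    have h3 : sNorm s x ^ (ζ - (sdeg s ℓ : ℝ)) ≤ C1 * P := by
      have : sNorm s x ^ (ζ - (sdeg s ℓ : ℝ)) = sNorm s x ^ (ζ - ζ') * P := by
        rw [hP, ← Real.rpow_add hSx]; congr 1; ring
      rw [this]
      exact mul_le_mul_of_nonneg_right
        (Real.rpow_le_rpow hSx.le hnear (by linarith [hζ'.2])) hP0
    have h4 : 1 ≤ A ^ ((sdeg s ℓ : ℝ) - ζ') * P := by
      have h5 : A ^ (ζ' - (sdeg s ℓ : ℝ)) ≤ P :=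
        Real.rpow_le_rpow_of_nonpos hSx hnear (by linarith [hζ'.2])
      calc (1 : ℝ) = A ^ ((sdeg s ℓ : ℝ) - ζ') * A ^ (ζ' - (sdeg s ℓ : ℝ)) := by
            rw [← Real.rpow_add hA0]; simp
        _ ≤ _ := mul_le_mul_of_nonneg_left h5 (by positivity)
    have h6 : Mρ * N * I ≤ C2 * N * P := by
      have h7 : 0 ≤ Mρ * N * I := by positivity
      calc Mρ * N * I ≤ Mρ * N * I * (A ^ ((sdeg s ℓ : ℝ) - ζ') * P) :=
            le_mul_of_one_le_right h7 h4
        _ = _ := by rw [hC2]; ring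
    have h8 : N * sNorm s x ^ (ζ - (sdeg s ℓ : ℝ)) ≤ C1 * N * P := by
      calc _ ≤ N * (C1 * P) := mul_le_mul_of_nonneg_left h3 hN
        _ = _ := by ring
    have h9 : 0 ≤ C3 * N * P := by positivity
    refine (abs_sub _ _).trans ?_
    have h10 : (C1 + C2 + C3) * N * P = C1 * N * P + C2 * N * P + C3 * N * P := by ring
    rw [h10]
    linarith

/-- The scaled bound for a fixed multiindex. -/
lemma scaled_bound {d : ℕ} [Nonempty (Fin d)] (s : Fin d → ℕ) (hs : ∀ i, 0 < s i) {ζ ζ' : ℝ}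
    (hζ₁ : -(∑ i, (s i : ℝ)) < ζ) (hζ₂ : ζ < 0) (hζ' : ζ' ∈ Set.Ico (ζ - 1) ζ)
    {ρ : (Fin d → ℝ) → ℝ} (hρ : ContDiff ℝ (⊤ : ℕ∞) ρ) (hρc : HasCompactSupport ρ)
    (hρ1 : (∫ y, ρ y) = 1) (ℓ : List (Fin d)) :
    ∃ C : ℝ, 0 ≤ C ∧ ∀ (K : (Fin d → ℝ) → ℝ) (N : ℝ), 0 ≤ N →
      ContDiffOn ℝ (⊤ : ℕ∞) K {x | x ≠ 0} → HasCompactSupport K →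
      (∀ ℓ' : List (Fin d), sdeg s ℓ' ≤ sdeg s ℓ + Finset.univ.sup s → ∀ x : Fin d → ℝ, x ≠ 0 →
        |mderiv ℓ' K x| ≤ N * sNorm s x ^ (ζ - (sdeg s ℓ' : ℝ))) →
      ∀ ε : ℝ, 0 < ε → ∀ x : Fin d → ℝ, x ≠ 0 →
        |mderiv ℓ
            (fun z => K z -
              ∫ y, (ε ^ (∑ i, s i) : ℝ)⁻¹ * ρ (fun i => (z i - y i) / ε ^ (s i)) * K y)
            x|
          ≤ C * ε ^ (ζ - ζ') * N * sNorm s x ^ (ζ' - (sdeg s ℓ : ℝ)) := by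
  obtain ⟨C, hC, H⟩ := unit_bound s hs hζ₁ hζ₂ hζ' hρ hρc hρ1 ℓ
  refine ⟨C, hC, ?_⟩
  intro K N hN hK hKc hb ε hε x hx
  set S := dil s ε hε with hS
  set F : (Fin d → ℝ) → ℝ := fun z => K z -
    ∫ y, (ε ^ (∑ i, s i) : ℝ)⁻¹ * ρ (fun i => (z i - y i) / ε ^ (s i)) * K y with hF
  have hFS : (fun w => F (S w)) = fun w => K (S w) - ∫ y, ρ (w - y) * K (S y) := by
    funext w
    simp only [hF]
    congr 1
    rw [integral_dil s ε hε, ← integral_const_mul]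
    refine integral_congr_ae (Filter.Eventually.of_forall fun y => ?_)
    have hp : (ε ^ (∑ i, s i) : ℝ) ≠ 0 := (pow_pos hε _).ne'
    have harg : (fun i => (S w i - dil s ε hε y i) / ε ^ s i) = w - y := by
      funext i
      rw [hS, dil_apply, dil_apply]
      have : ε ^ s i ≠ 0 := (pow_pos hε _).ne'
      simp only [Pi.sub_apply]
      field_simp
    simp only [harg]
    rw [← hS]
    field_simp
  have hS0 : ∀ w, w ≠ 0 → S w ≠ 0 := fun w hw h => hw (by simpa using h)
  have h1 := H (fun w => K (S w)) (N * ε ^ ζ) (by positivity)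
    (by
      refine hK.comp S.contDiff.contDiffOn ?_
      intro w hw
      exact hS0 w hw)
    (hKc.comp_homeomorph S.toHomeomorph)
    (by
      intro ℓ' hℓ' w hw
      rw [mderiv_dil, abs_mul, abs_of_pos (pow_pos hε _)]
      have h2 := hb ℓ' hℓ' (S w) (hS0 w hw)
      have hw0 := sNorm_pos s hw
      rw [hS, sNorm_dil s hs, Real.mul_rpow hε.le hw0.le, Real.rpow_sub hε, Real.rpow_natCast] at h2
      have hp : 0 < ε ^ sdeg s ℓ' := pow_pos hε _
      calc _ ≤ ε ^ sdeg s ℓ' * (N * (ε ^ ζ / ε ^ sdeg s ℓ' * sNorm s w ^ (ζ - (sdeg s ℓ' : ℝ)))) :=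
            mul_le_mul_of_nonneg_left h2 hp.le
        _ = _ := by field_simp)
    (S.symm x) (fun h => hx (by simpa using h))
  rw [← hFS, mderiv_dil] at h1
  have hSx : sNorm s x = ε * sNorm s (S.symm x) := by
    rw [← sNorm_dil s hs ε hε, ← hS]; simp
  rw [← hS] at h1
  beta_reduce at h1
  rw [ContinuousLinearEquiv.apply_symm_apply, abs_mul, abs_of_pos (pow_pos hε _)] at h1
  have hp : 0 < ε ^ sdeg s ℓ := pow_pos hε _
  have hw0 : 0 ≤ sNorm s (S.symm x) := sNorm_nonneg _ _
  rw [hSx, Real.mul_rpow hε.le hw0]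
  have h3 : ε ^ (ζ - ζ') * ε ^ (ζ' - (sdeg s ℓ : ℝ)) = ε ^ ζ / ε ^ sdeg s ℓ := by
    rw [← Real.rpow_add hε, ← Real.rpow_natCast ε (sdeg s ℓ), ← Real.rpow_sub hε]
    congr 1; ring
  calc |mderiv ℓ F x|
      ≤ (C * (N * ε ^ ζ) * sNorm s (S.symm x) ^ (ζ' - (sdeg s ℓ : ℝ))) / ε ^ sdeg s ℓ := by
        rw [le_div_iff₀ hp]; linarith
    _ = C * N * (ε ^ ζ / ε ^ sdeg s ℓ) * sNorm s (S.symm x) ^ (ζ' - (sdeg s ℓ : ℝ)) := by ring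
    _ = _ := by rw [← h3]; ring

lemma length_le_sdeg {d : ℕ} (s : Fin d → ℕ) (hs : ∀ i, 0 < s i) (ℓ : List (Fin d)) :
    ℓ.length ≤ sdeg s ℓ := by
  induction ℓ with
  | nil => simp
  | cons i ℓ ih =>
    have := hs i
    simp only [sdeg, List.map_cons, List.sum_cons, List.length_cons] at ih ⊢
    omega


/-- Second part of Lemma 10.17: if `K` is of order `ζ ∈ (-|s|, 0)` and `K_ε = K * ρ_ε` is its
mollification, then for every `ζ̄ ∈ [ζ-1, ζ)` and every `m ≥ 0`,
`⦀K - K_ε⦀_{ζ̄;m} ≤ C ε^{ζ - ζ̄} ⦀K⦀_{ζ;m̄}` with `m̄ = m + max_i s_i`, uniformly over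
`ε ∈ (0,1]`. -/
theorem stmt_10 {d : ℕ} (s : Fin d → ℕ) (hs : ∀ i, 0 < s i) (ζ ζ' : ℝ)
    (hζ₁ : -(∑ i, (s i : ℝ)) < ζ) (hζ₂ : ζ < 0) (hζ' : ζ' ∈ Set.Ico (ζ - 1) ζ) (m : ℕ)
    (ρ : (Fin d → ℝ) → ℝ) (hρ : ContDiff ℝ (⊤ : ℕ∞) ρ) (hρc : HasCompactSupport ρ)
    (hρ1 : (∫ y, ρ y) = 1) :
    ∃ C : ℝ, ∀ (K : (Fin d → ℝ) → ℝ) (N : ℝ),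
      ContDiffOn ℝ (⊤ : ℕ∞) K {x | x ≠ 0} → HasCompactSupport K →
      (∀ ℓ : List (Fin d), sdeg s ℓ ≤ m + Finset.univ.sup s → ∀ x : Fin d → ℝ, x ≠ 0 →
        |mderiv ℓ K x| ≤ N * sNorm s x ^ (ζ - (sdeg s ℓ : ℝ))) →
      ∀ ε : ℝ, 0 < ε → ε ≤ 1 → ∀ ℓ : List (Fin d), sdeg s ℓ ≤ m → ∀ x : Fin d → ℝ, x ≠ 0 →
        |mderiv ℓ
            (fun z => K z -
              ∫ y, (ε ^ (∑ i, s i) : ℝ)⁻¹ * ρ (fun i => (z i - y i) / ε ^ (s i)) * K y)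
            x|
          ≤ C * ε ^ (ζ - ζ') * N * sNorm s x ^ (ζ' - (sdeg s ℓ : ℝ)) := by
  have hne : Nonempty (Fin d) := by
    by_contra h
    rw [not_nonempty_iff] at h
    simp at hζ₁
    linarith
  choose C hC H using fun ℓ : List (Fin d) => scaled_bound s hs hζ₁ hζ₂ hζ' hρ hρc hρ1 ℓ
  have hfin : {ℓ : List (Fin d) | sdeg s ℓ ≤ m}.Finite :=
    (List.finite_length_le (Fin d) m).subset fun ℓ hℓ => (length_le_sdeg s hs ℓ).trans hℓ
  refine ⟨∑ ℓ ∈ hfin.toFinset, C ℓ, ?_⟩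
  intro K N hK hKc hb ε hε _ ℓ hℓ x hx
  have hSx := sNorm_pos s hx
  have hN : 0 ≤ N := by
    have h := (abs_nonneg _).trans (hb [] (by simp [sdeg]) x hx)
    exact nonneg_of_mul_nonneg_left h (Real.rpow_pos_of_pos hSx _)
  refine (H ℓ K N hN hK hKc (fun ℓ' hℓ' => hb ℓ' (by omega)) ε hε x hx).trans ?_
  have hle : C ℓ ≤ ∑ ℓ ∈ hfin.toFinset, C ℓ :=
    Finset.single_le_sum (f := C) (fun ℓ _ => hC ℓ) (hfin.mem_toFinset.2 hℓ)
  gcongr
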